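/- Second-order asymptotics for lossless source coding: let P_X be a pmf on a finite alphabet 𝒳 with source dispersion V(P_X) > 0. For every ε ∈ (0,1), log M*(n,ε) = n H(P_X) + √(n V(P_X)) Q^{-1}(ε) + O(log n); i.e., there exist C > 0 and n₀ ∈ ℕ such that for all n ≥ n₀, |log M*(n,ε) − n H(P_X) − √(n V(P_X)) Q^{-1}(ε)| ≤ C log n. -/

import Mathlib

/-!
Second-order asymptotics for lossless source coding (Strassen / Hayashi).
-/

open scoped BigOperators

noncomputable section

/-- i.i.d. product pmf on length-`n` strings. -/
def iidP {α : Type*} [Fintype α] (p : α → ℝ) (n : ℕ) : (Fin n → α) → ℝ :=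
  fun xs => ∏ i, p (xs i)

/-- Probability of an event under a pmf on a finite space. -/
def Pr {Ω : Type*} [Fintype Ω] (μ : Ω → ℝ) (A : Set Ω) : ℝ :=
  ∑ ω, A.indicator μ ω

/-- Shannon entropy `H(P) = E[−log P(X)]`. -/
def entropy {α : Type*} [Fintype α] (p : α → ℝ) : ℝ :=
  ∑ x, p x * (-Real.log (p x))

/-- Source dispersion `V(P) = Var[−log P(X)]`. -/
def sourceDispersion {α : Type*} [Fintype α] (p : α → ℝ) : ℝ :=
  ∑ x, p x * (-Real.log (p x) - entropy p) ^ 2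

/-- The minimum number of codewords of an `(n,M)`-code for lossless source coding
whose error probability is at most `ε`. -/
def Mstar {𝒳 : Type} [Fintype 𝒳] (P : 𝒳 → ℝ) (n : ℕ) (ε : ℝ) : ℕ :=
  sInf {M : ℕ | 0 < M ∧ ∃ (f : (Fin n → 𝒳) → Fin M) (φ : Fin M → (Fin n → 𝒳)),
    Pr (iidP P n) {xs | φ (f xs) ≠ xs} ≤ ε}

/-- The Gaussian complementary cdf `Q(t) = ∫_t^∞ (2π)^{-1/2} e^{-u²/2} du`. -/
def gaussQ (t : ℝ) : ℝ :=
  ∫ u in Set.Ioi t, Real.exp (-u ^ 2 / 2) / Real.sqrt (2 * Real.pi)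

section SOG
open MeasureTheory

lemma so_q_int : Integrable (fun x : ℝ => Real.exp (-x ^ 2 / 2)) := by
  have := integrable_exp_neg_mul_sq (b := 1/2) (by norm_num)
  refine this.congr (Filter.Eventually.of_forall fun x => ?_)
  simp only; congr 1; ring

lemma so_q_integral : ∫ x : ℝ, Real.exp (-x ^ 2 / 2) = Real.sqrt (2 * Real.pi) := by
  have := integral_gaussian (1/2)
  rw [show (2 * Real.pi) = Real.pi / (1/2) by ring, ← this]
  congr 1; ext x; congr 1; ring

lemma so_tail {w : ℝ} (hw : 0 < w) :
    w * ∫ x in Set.Ioi w, Real.exp (-x ^ 2 / 2) ≤ Real.exp (-w ^ 2 / 2) := by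
  have hd : ∀ x ∈ Set.Ici w, HasDerivAt (fun x : ℝ => -Real.exp (-x ^ 2 / 2))
      (x * Real.exp (-x ^ 2 / 2)) x := by
    intro x _
    have h1 : HasDerivAt (fun x : ℝ => -x ^ 2 / 2) (-x) x := by
      exact (((hasDerivAt_pow 2 x).neg).div_const 2).congr_deriv (by norm_num; try ring)
    exact h1.exp.neg.congr_deriv (by ring)
  have ht : Filter.Tendsto (fun x : ℝ => -Real.exp (-x ^ 2 / 2)) Filter.atTop (nhds 0) := by
    rw [show (0:ℝ) = -0 by simp]
    refine Filter.Tendsto.neg (Real.tendsto_exp_atBot.comp ?_)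
    have : Filter.Tendsto (fun x : ℝ => x ^ 2 / 2) Filter.atTop Filter.atTop :=
      (Filter.tendsto_pow_atTop (by norm_num)).atTop_div_const (by norm_num)
    have := Filter.tendsto_neg_atTop_atBot.comp this
    refine this.congr fun x => ?_
    simp; ring
  have hnn : ∀ x ∈ Set.Ioi w, 0 ≤ x * Real.exp (-x ^ 2 / 2) := fun x hx =>
    mul_nonneg (hw.le.trans (le_of_lt hx)) (Real.exp_pos _).le
  have hi := integrableOn_Ioi_deriv_of_nonneg' hd hnn ht
  have hv := integral_Ioi_of_hasDerivAt_of_nonneg' hd hnn ht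
  rw [← integral_const_mul]
  calc _ ≤ ∫ x in Set.Ioi w, x * Real.exp (-x ^ 2 / 2) := by
        refine setIntegral_mono_on (so_q_int.integrableOn.const_mul w) hi measurableSet_Ioi ?_
        intro x hx
        exact mul_le_mul_of_nonneg_right (le_of_lt hx) (Real.exp_pos _).le
    _ = _ := by rw [hv]; ring

/-- Solution of Stein's equation. -/
lemma so_stein : ∃ B : ℝ, 0 < B ∧ ∀ h : ℝ → ℝ, Continuous h → (∀ x, 0 ≤ h x) → (∀ x, h x ≤ 1) →
    ∃ f : ℝ → ℝ,
      (∀ w, HasDerivAt f (w * f w +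
        (h w - ∫ x, h x * (Real.exp (-x ^ 2 / 2) / Real.sqrt (2 * Real.pi)))) w) ∧
      (∀ w, |f w| ≤ B) ∧ (∀ w, |w * f w| ≤ 1) ∧
      (∀ w, |w * f w +
        (h w - ∫ x, h x * (Real.exp (-x ^ 2 / 2) / Real.sqrt (2 * Real.pi)))| ≤ 2) := by
  refine ⟨Real.exp (1/2) * Real.sqrt (2 * Real.pi) + 1, by positivity, ?_⟩
  intro h hc h0 h1
  have hs : 0 < Real.sqrt (2 * Real.pi) := by positivity
  set N := ∫ x, h x * (Real.exp (-x ^ 2 / 2) / Real.sqrt (2 * Real.pi)) with hN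
  have hhq : Integrable (fun x => h x * Real.exp (-x ^ 2 / 2)) := by
    refine so_q_int.mono' (by fun_prop) (Filter.Eventually.of_forall fun x => ?_)
    rw [Real.norm_eq_abs, abs_of_nonneg (mul_nonneg (h0 x) (Real.exp_pos _).le)]
    exact mul_le_of_le_one_left (Real.exp_pos _).le (h1 x)
  have hN' : N * Real.sqrt (2 * Real.pi) = ∫ x, h x * Real.exp (-x ^ 2 / 2) := by
    rw [hN, ← integral_mul_const]
    congr 1; ext x; field_simp
  have hN0 : 0 ≤ N := integral_nonneg fun x => mul_nonneg (h0 x) (by positivity)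
  have hN1 : N ≤ 1 := by
    have : N * Real.sqrt (2 * Real.pi) ≤ 1 * Real.sqrt (2 * Real.pi) := by
      rw [hN', one_mul, ← so_q_integral]
      refine integral_mono hhq so_q_int fun x => ?_
      exact mul_le_of_le_one_left (Real.exp_pos _).le (h1 x)
    exact le_of_mul_le_mul_right this hs
  set k : ℝ → ℝ := fun x => (h x - N) * Real.exp (-x ^ 2 / 2) with hk
  have hkc : Continuous k := by fun_prop
  have hki : Integrable k := by
    have := hhq.sub (so_q_int.const_mul N)
    refine this.congr (Filter.Eventually.of_forall fun x => ?_)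
    simp [hk]; ring
  have hk0 : ∫ x, k x = 0 := by
    have : ∫ x, k x = ∫ x, (h x * Real.exp (-x ^ 2 / 2) - N * Real.exp (-x ^ 2 / 2)) := by
      congr 1; ext x; simp [hk]; ring
    rw [this, integral_sub hhq (so_q_int.const_mul N), integral_const_mul, so_q_integral, hN']
    ring
  have hhN : ∀ x, |h x - N| ≤ 1 := fun x => by
    rw [abs_le]; constructor <;> linarith [h0 x, h1 x]
  have hkb : ∀ x, ‖k x‖ ≤ Real.exp (-x ^ 2 / 2) := fun x => by
    rw [Real.norm_eq_abs, hk, abs_mul, abs_of_pos (Real.exp_pos _)]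
    exact mul_le_of_le_one_left (Real.exp_pos _).le (hhN x)
  have hset : ∀ s : Set ℝ, MeasurableSet s → |∫ x in s, k x| ≤ ∫ x in s, Real.exp (-x ^ 2 / 2) := by
    intro s hs
    exact norm_integral_le_of_norm_le so_q_int.integrableOn
      (Filter.Eventually.of_forall hkb)
  set I : ℝ → ℝ := fun w => ∫ x in Set.Iic w, k x with hI
  have hId : ∀ w, HasDerivAt I (k w) w := by
    intro w
    have h1 : I = fun w => I 0 + ∫ x in (0:ℝ)..w, k x := by
      ext w
      rw [← intervalIntegral.integral_Iic_sub_Iic hki.integrableOn hki.integrableOn]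
      simp [hI]
    rw [h1]
    refine HasDerivAt.const_add _ ?_
    exact intervalIntegral.integral_hasDerivAt_right (hkc.intervalIntegrable _ _)
      (hkc.stronglyMeasurableAtFilter _ _) hkc.continuousAt
  have hIpos : ∀ w, |I w| ≤ ∫ x in Set.Ioi w, Real.exp (-x ^ 2 / 2) := by
    intro w
    have : I w = -∫ x in Set.Ioi w, k x := by
      have := intervalIntegral.integral_Iic_add_Ioi (b := w) hki.integrableOn hki.integrableOn
      rw [hk0] at this; simp only [hI]; linarith
    rw [this, abs_neg]; exact hset _ measurableSet_Ioi
  have hIneg : ∀ w, |I w| ≤ ∫ x in Set.Ioi (-w), Real.exp (-x ^ 2 / 2) := by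
    intro w
    have := integral_comp_neg_Iic w (fun x : ℝ => Real.exp (-x ^ 2 / 2))
    rw [← this]
    refine (hset _ measurableSet_Iic).trans (le_of_eq ?_)
    congr 1; ext x; congr 2; ring
  have hwI : ∀ w, |w * I w| ≤ Real.exp (-w ^ 2 / 2) := by
    intro w
    rw [abs_mul]
    rcases lt_trichotomy w 0 with hw | hw | hw
    · have := so_tail (w := -w) (by linarith)
      rw [abs_of_neg hw]
      refine (mul_le_mul_of_nonneg_left (hIneg w) (by linarith)).trans (this.trans (le_of_eq ?_))
      congr 2; ring
    · subst hw; simp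
    · rw [abs_of_pos hw]
      exact (mul_le_mul_of_nonneg_left (hIpos w) hw.le).trans (so_tail hw)
  set f : ℝ → ℝ := fun w => Real.exp (w ^ 2 / 2) * I w with hf
  have hee : ∀ w : ℝ, Real.exp (w ^ 2 / 2) * Real.exp (-w ^ 2 / 2) = 1 := by
    intro w; rw [← Real.exp_add]; rw [← Real.exp_zero]; congr 1; ring
  have hwf : ∀ w, |w * f w| ≤ 1 := by
    intro w
    have : w * f w = Real.exp (w ^ 2 / 2) * (w * I w) := by simp only [hf]; ring
    rw [this, abs_mul, abs_of_pos (Real.exp_pos _), ← hee w]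
    exact mul_le_mul_of_nonneg_left (hwI w) (Real.exp_pos _).le
  refine ⟨f, ?_, ?_, hwf, ?_⟩
  · intro w
    have h1 : HasDerivAt (fun x : ℝ => x ^ 2 / 2) w w := by
      exact ((hasDerivAt_pow 2 w).div_const 2).congr_deriv (by norm_num)
    refine (h1.exp.mul (hId w)).congr_deriv ?_
    simp only [hf, hk]
    linear_combination (h w - N) * hee w
  · intro w
    by_cases hw : |w| ≤ 1
    · have hb : |I w| ≤ Real.sqrt (2 * Real.pi) := by
        rw [← so_q_integral]
        refine (hIpos w).trans (setIntegral_le_integral so_q_int ?_)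
        exact Filter.Eventually.of_forall fun x => (Real.exp_pos _).le
      have he : Real.exp (w ^ 2 / 2) ≤ Real.exp (1/2) := by
        apply Real.exp_le_exp.2
        have := (sq_le_one_iff_abs_le_one w).2 hw
        linarith
      simp only [hf]
      rw [abs_mul, abs_of_pos (Real.exp_pos _)]
      have := mul_le_mul he hb (abs_nonneg _) (Real.exp_pos _).le
      linarith
    · push Not at hw
      have := hwf w
      rw [abs_mul] at this
      have h2 : |f w| ≤ |w| * |f w| := le_mul_of_one_le_left (abs_nonneg _) hw.le
      have : 0 < Real.exp (1/2) * Real.sqrt (2 * Real.pi) := by positivity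
      linarith
  · intro w
    have := abs_add_le (w * f w) (h w - N)
    linarith [hwf w, hhN w]
end SOG

/-- Expectation under the i.i.d. pmf. -/
def soEx {α : Type*} [Fintype α] (P : α → ℝ) (n : ℕ) (F : (Fin n → α) → ℝ) : ℝ :=
  ∑ x, iidP P n x * F x

section SO
variable {α : Type*} [Fintype α] {P : α → ℝ}

lemma so_iid_nonneg (hP0 : ∀ x, 0 ≤ P x) (n : ℕ) (x : Fin n → α) : 0 ≤ iidP P n x :=
  Finset.prod_nonneg fun _ _ => hP0 _

lemma so_iid_sum (hP1 : ∑ x, P x = 1) (n : ℕ) : ∑ x, iidP P n x = 1 := by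
  classical
  have := Finset.prod_univ_sum (fun _ : Fin n => (Finset.univ : Finset α)) (fun _ a => P a)
  simp only [hP1, Finset.prod_const_one, Fintype.piFinset_univ] at this
  exact this.symm

lemma so_Ex_mono (hP0 : ∀ x, 0 ≤ P x) {n : ℕ} {F G : (Fin n → α) → ℝ} (h : ∀ x, F x ≤ G x) :
    soEx P n F ≤ soEx P n G :=
  Finset.sum_le_sum fun x _ => mul_le_mul_of_nonneg_left (h x) (so_iid_nonneg hP0 n x)

lemma so_Ex_abs (hP0 : ∀ x, 0 ≤ P x) {n : ℕ} (F : (Fin n → α) → ℝ) :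
    |soEx P n F| ≤ soEx P n (fun x => |F x|) := by
  refine (Finset.abs_sum_le_sum_abs _ _).trans (le_of_eq ?_)
  refine Finset.sum_congr rfl fun x _ => ?_
  rw [abs_mul, abs_of_nonneg (so_iid_nonneg hP0 n x)]

lemma so_Ex_const (hP1 : ∑ x, P x = 1) {n : ℕ} (c : ℝ) : soEx P n (fun _ => c) = c := by
  unfold soEx; rw [← Finset.sum_mul, so_iid_sum hP1, one_mul]

lemma so_Ex_add {n : ℕ} (F G : (Fin n → α) → ℝ) :
    soEx P n (fun x => F x + G x) = soEx P n F + soEx P n G := by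
  simp [soEx, mul_add, Finset.sum_add_distrib]

lemma so_Ex_sub {n : ℕ} (F G : (Fin n → α) → ℝ) :
    soEx P n (fun x => F x - G x) = soEx P n F - soEx P n G := by
  simp [soEx, mul_sub, Finset.sum_sub_distrib]

lemma so_Ex_smul {n : ℕ} (c : ℝ) (F : (Fin n → α) → ℝ) :
    soEx P n (fun x => c * F x) = c * soEx P n F := by
  unfold soEx; rw [Finset.mul_sum]; exact Finset.sum_congr rfl fun x _ => by ring

lemma so_Ex_sum {n : ℕ} {ι : Type*} (s : Finset ι) (F : ι → (Fin n → α) → ℝ) :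
    soEx P n (fun x => ∑ i ∈ s, F i x) = ∑ i ∈ s, soEx P n (F i) := by
  unfold soEx; simp only [Finset.mul_sum]; rw [Finset.sum_comm]

lemma so_indep (hP1 : ∑ x, P x = 1) {n : ℕ} (i : Fin n) (u : α → ℝ) (G : (Fin n → α) → ℝ)
    (hG : ∀ x y, (∀ j, j ≠ i → x j = y j) → G x = G y) :
    soEx P n (fun x => u (x i) * G x) = (∑ a, P a * u a) * soEx P n G := by
  obtain _ | m := n
  · exact i.elim0
  have hne : Nonempty α := by
    by_contra h
    rw [not_nonempty_iff] at h
    simp at hP1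
  obtain ⟨a0⟩ := hne
  have key : ∀ v : α → ℝ, soEx P (m+1) (fun x => v (x i) * G x) =
      (∑ a, P a * v a) * ∑ y : Fin m → α, iidP P m y * G (i.insertNth a0 y) := by
    intro v
    unfold soEx
    rw [← (Fin.insertNthEquiv (fun _ => α) i).sum_comp, Fintype.sum_prod_type, Finset.sum_mul_sum]
    refine Finset.sum_congr rfl fun a _ => Finset.sum_congr rfl fun y _ => ?_
    have h1 : G (i.insertNth a y) = G (i.insertNth a0 y) := by
      apply hG
      intro j hj
      obtain ⟨k, rfl⟩ := Fin.exists_succAbove_eq hj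
      simp
    have h1' : G ((Fin.insertNthEquiv (fun _ => α) i) (a, y)) = G (i.insertNth a0 y) := h1
    beta_reduce
    rw [h1']
    simp only [Fin.insertNthEquiv_apply, iidP, Fin.insertNth_apply_same]
    rw [Fin.prod_univ_succAbove _ i]
    simp only [Fin.insertNth_apply_same, Fin.insertNth_apply_succAbove]
    ring
  have k1 := key (fun _ => 1)
  simp only [one_mul, mul_one, hP1] at k1
  rw [key u, ← k1]

/-- Second moment of a centered sum. -/
lemma so_second (hP1 : ∑ x, P x = 1) (n : ℕ) (u : α → ℝ) (hu : ∑ a, P a * u a = 0) :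
    soEx P n (fun x => (∑ i, u (x i)) ^ 2) = n * ∑ a, P a * u a ^ 2 := by
  have h1 : ∀ x : Fin n → α, (∑ i, u (x i)) ^ 2 =
      ∑ i, (u (x i) ^ 2 * 1 + u (x i) * (∑ j ∈ Finset.univ.erase i, u (x j))) := by
    intro x
    rw [sq, Finset.sum_mul]
    refine Finset.sum_congr rfl fun i _ => ?_
    rw [← Finset.add_sum_erase _ _ (Finset.mem_univ i)]
    ring
  simp only [h1]
  rw [so_Ex_sum]
  have h2 : ∀ i : Fin n, soEx P n (fun x => u (x i) ^ 2 * 1 +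
      u (x i) * (∑ j ∈ Finset.univ.erase i, u (x j))) = ∑ a, P a * u a ^ 2 := by
    intro i
    rw [so_Ex_add, so_indep hP1 i (fun a => u a ^ 2) (fun _ => 1) (fun _ _ _ => rfl),
      so_indep hP1 i u, hu, so_Ex_const hP1]
    · ring
    · intro x y hxy
      refine Finset.sum_congr rfl fun j hj => ?_
      rw [hxy j (Finset.ne_of_mem_erase hj)]
  rw [Finset.sum_congr rfl fun i _ => h2 i]
  simp

/-- First absolute moment. -/
lemma so_first (hP0 : ∀ x, 0 ≤ P x) (hP1 : ∑ x, P x = 1) (n : ℕ) (F : (Fin n → α) → ℝ)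
    (c : ℝ) (hc : 0 < c) (hF : soEx P n (fun x => F x ^ 2) ≤ c ^ 2) :
    soEx P n (fun x => |F x|) ≤ c := by
  have h : ∀ x, |F x| ≤ (1 / (2 * c)) * F x ^ 2 + c / 2 := by
    intro x
    have : (1 / (2 * c)) * F x ^ 2 + c / 2 - |F x| = (|F x| - c) ^ 2 / (2 * c) := by
      rw [← sq_abs]; field_simp; ring
    have h2 : 0 ≤ (|F x| - c) ^ 2 / (2 * c) := by positivity
    linarith
  refine (so_Ex_mono hP0 h).trans ?_
  rw [so_Ex_add, so_Ex_smul, so_Ex_const hP1]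
  have := mul_le_mul_of_nonneg_left hF (show 0 ≤ 1 / (2 * c) by positivity)
  have h3 : 1 / (2 * c) * c ^ 2 = c / 2 := by field_simp
  linarith

/-- normalized sum -/
def soW (g : α → ℝ) (n : ℕ) (x : Fin n → α) : ℝ := ∑ i, g (x i) / Real.sqrt n

lemma so_W_split (g : α → ℝ) (n : ℕ) (x : Fin n → α) (i : Fin n) :
    soW g n x = g (x i) / Real.sqrt n + ∑ j ∈ Finset.univ.erase i, g (x j) / Real.sqrt n :=
  (Finset.add_sum_erase _ _ (Finset.mem_univ i)).symm

lemma so_W2 (hP1 : ∑ x, P x = 1) (g : α → ℝ) (h1 : ∑ a, P a * g a = 0)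
    (h2 : ∑ a, P a * g a ^ 2 = 1) (n : ℕ) (hn : 0 < n) :
    soEx P n (fun x => soW g n x ^ 2) = 1 := by
  have := so_second hP1 n (fun a => g a / Real.sqrt n) (by
    simp only [← mul_div_assoc]; rw [← Finset.sum_div, h1, zero_div])
  have hn' : (0:ℝ) < n := by exact_mod_cast hn
  unfold soW
  rw [this]
  simp only [div_pow, Real.sq_sqrt hn'.le, ← mul_div_assoc]
  rw [← Finset.sum_div, h2]; field_simp

/-- Concentration. -/
lemma so_conc (hP0 : ∀ x, 0 ≤ P x) (hP1 : ∑ x, P x = 1) (g : α → ℝ) (h1 : ∑ a, P a * g a = 0)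
    (h2 : ∑ a, P a * g a ^ 2 = 1) (K : ℝ) (hK : 1 ≤ K) (hg : ∀ a, |g a| ≤ K)
    (n : ℕ) (hn : 0 < n) (a b : ℝ) (hab : a ≤ b) :
    soEx P n (fun x => if a ≤ soW g n x ∧ soW g n x ≤ b then 1 else 0) ≤
      (b - a) / 2 + K / Real.sqrt n + (K ^ 2 + 1) / Real.sqrt n := by
  have hn' : (0:ℝ) < n := by exact_mod_cast hn
  have hsn : 0 < Real.sqrt n := Real.sqrt_pos.2 hn'
  have hsq : Real.sqrt n ^ 2 = n := Real.sq_sqrt hn'.le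
  set δ := K / Real.sqrt n with hδ
  have hδ0 : 0 < δ := by positivity
  have hξ : ∀ a, |g a / Real.sqrt n| ≤ δ := fun a => by
    rw [abs_div, abs_of_pos hsn]; exact div_le_div_of_nonneg_right (hg a) hsn.le
  set r := (b - a) / 2 + δ with hr
  have hr0 : 0 < r := by rw [hr]; linarith
  set m := (a + b) / 2 with hm
  set f : ℝ → ℝ := fun w => max (-r) (min r (w - m)) with hf
  have hfm : Monotone f := by
    intro u v huv
    exact max_le_max le_rfl (min_le_min le_rfl (by linarith))
  have hfb : ∀ w, |f w| ≤ r := by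
    intro w
    rw [abs_le]
    exact ⟨le_max_left _ _, max_le (by linarith) (min_le_left _ _)⟩
  have hfl : ∀ w, a - δ ≤ w → w ≤ b + δ → f w = w - m := by
    intro w hw1 hw2
    simp only [hf]
    rw [min_eq_right (by rw [hr, hm]; linarith), max_eq_right (by rw [hr, hm]; linarith)]
  have hup : soEx P n (fun x => soW g n x * f (soW g n x)) ≤ r := by
    have hW1 : soEx P n (fun x => |soW g n x|) ≤ 1 :=
      so_first hP0 hP1 n _ 1 one_pos (by rw [so_W2 hP1 g h1 h2 n hn]; norm_num)
    have : soEx P n (fun x => soW g n x * f (soW g n x)) ≤ soEx P n (fun x => r * |soW g n x|) := by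
      refine so_Ex_mono hP0 fun x => ?_
      refine (le_abs_self _).trans ?_
      rw [abs_mul, mul_comm]
      exact mul_le_mul_of_nonneg_right (hfb _) (abs_nonneg _)
    rw [so_Ex_smul] at this
    nlinarith
  set Y : (Fin n → α) → ℝ := fun x => ∑ i, ((g (x i)) ^ 2 - 1) / n with hY
  have hYsq : soEx P n (fun x => Y x ^ 2) ≤ ((K ^ 2 + 1) / Real.sqrt n) ^ 2 := by
    have := so_second hP1 n (fun a => (g a ^ 2 - 1) / n) (by
      simp only [← mul_div_assoc, mul_sub, mul_one]
      rw [← Finset.sum_div, Finset.sum_sub_distrib, h2, hP1]; simp)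
    simp only [hY]
    rw [this]
    have hb : ∑ a, P a * ((g a ^ 2 - 1) / n) ^ 2 ≤ ∑ a, P a * ((K ^ 2 + 1) / n) ^ 2 := by
      refine Finset.sum_le_sum fun a _ => mul_le_mul_of_nonneg_left ?_ (hP0 a)
      have h3 : g a ^ 2 ≤ K ^ 2 := sq_le_sq' (by linarith [neg_abs_le (g a), hg a])
        ((le_abs_self _).trans (hg a))
      rw [div_pow, div_pow]
      refine div_le_div_of_nonneg_right ?_ (by positivity)
      apply sq_le_sq'
      · nlinarith [sq_nonneg (g a), sq_nonneg K]
      · linarith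
    rw [← Finset.sum_mul, hP1, one_mul] at hb
    refine (mul_le_mul_of_nonneg_left hb hn'.le).trans (le_of_eq ?_)
    rw [div_pow, div_pow, hsq]; field_simp
  have hY1 := so_first hP0 hP1 n Y _ (by positivity) hYsq
  have hlow : soEx P n (fun x => (if a ≤ soW g n x ∧ soW g n x ≤ b then 1 else 0) - |Y x|) ≤
      soEx P n (fun x => soW g n x * f (soW g n x)) := by
    have e1 : soEx P n (fun x => soW g n x * f (soW g n x)) =
        soEx P n (fun x => ∑ i, g (x i) / Real.sqrt n * (f (soW g n x) -
          f (∑ j ∈ Finset.univ.erase i, g (x j) / Real.sqrt n))) := by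
      rw [so_Ex_sum]
      have : ∀ x : Fin n → α, soW g n x * f (soW g n x) =
          ∑ i, g (x i) / Real.sqrt n * f (soW g n x) := by
        intro x; rw [← Finset.sum_mul]; rfl
      simp only [this]
      rw [so_Ex_sum]
      refine Finset.sum_congr rfl fun i _ => ?_
      simp only [mul_sub]
      rw [so_Ex_sub, so_indep hP1 i (fun a => g a / Real.sqrt n)
        (fun x => f (∑ j ∈ Finset.univ.erase i, g (x j) / Real.sqrt n))]
      · simp only [← mul_div_assoc]; rw [← Finset.sum_div, h1]; simp
      · intro x y hxy
        congr 1
        refine Finset.sum_congr rfl fun j hj => ?_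
        rw [hxy j (Finset.ne_of_mem_erase hj)]
    rw [e1]
    refine so_Ex_mono hP0 fun x => ?_
    have hterm : ∀ i, 0 ≤ g (x i) / Real.sqrt n * (f (soW g n x) -
          f (∑ j ∈ Finset.univ.erase i, g (x j) / Real.sqrt n)) := by
      intro i
      have hs := so_W_split g n x i
      rcases le_total 0 (g (x i) / Real.sqrt n) with h | h
      · exact mul_nonneg h (sub_nonneg.2 (hfm (by linarith)))
      · exact mul_nonneg_of_nonpos_of_nonpos h (sub_nonpos.2 (hfm (by linarith)))
    split_ifs with hx
    · have : ∑ i, g (x i) / Real.sqrt n * (f (soW g n x) -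
          f (∑ j ∈ Finset.univ.erase i, g (x j) / Real.sqrt n)) = 1 + Y x := by
        have h3 : ∀ i, g (x i) / Real.sqrt n * (f (soW g n x) -
          f (∑ j ∈ Finset.univ.erase i, g (x j) / Real.sqrt n)) = g (x i) ^ 2 / n := by
          intro i
          have hs := so_W_split g n x i
          have hb := abs_le.1 (hξ (x i))
          rw [hfl _ (by linarith) (by linarith), hfl _ (by linarith) (by linarith)]
          rw [show soW g n x - m - (∑ j ∈ Finset.univ.erase i, g (x j) / Real.sqrt n - m) =
            g (x i) / Real.sqrt n by linarith, ← sq, div_pow, hsq]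
        simp only [h3, hY, sub_div]
        rw [Finset.sum_sub_distrib]
        simp; field_simp; ring
      rw [this]
      linarith [neg_abs_le (Y x)]
    · have := Finset.sum_nonneg fun i (_ : i ∈ Finset.univ) => hterm i
      linarith [abs_nonneg (Y x)]
  rw [so_Ex_sub] at hlow
  linarith

/-- Stein bound. -/
lemma so_stein_bound (hP0 : ∀ x, 0 ≤ P x) (hP1 : ∑ x, P x = 1) (g : α → ℝ)
    (h1 : ∑ a, P a * g a = 0)
    (h2 : ∑ a, P a * g a ^ 2 = 1) (K : ℝ) (hK : 1 ≤ K) (hg : ∀ a, |g a| ≤ K)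
    (n : ℕ) (hn : 0 < n) (f f' D : ℝ → ℝ) (hf : ∀ w, HasDerivAt f (f' w) w)
    (hD : ∀ w u v, |u - w| ≤ K / Real.sqrt n → |v - w| ≤ K / Real.sqrt n → |f' u - f' v| ≤ D w) :
    |soEx P n (fun x => f' (soW g n x) - soW g n x * f (soW g n x))| ≤
      (1 + K ^ 2) * soEx P n (fun x => D (soW g n x)) := by
  have hn' : (0:ℝ) < n := by exact_mod_cast hn
  have hsn : 0 < Real.sqrt n := Real.sqrt_pos.2 hn'
  have hsq : Real.sqrt n ^ 2 = n := Real.sq_sqrt hn'.le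
  set δ := K / Real.sqrt n with hδ
  have hδ0 : 0 < δ := by positivity
  have hξ : ∀ a, |g a / Real.sqrt n| ≤ δ := fun a => by
    rw [abs_div, abs_of_pos hsn]; exact div_le_div_of_nonneg_right (hg a) hsn.le
  set V : Fin n → (Fin n → α) → ℝ :=
    fun i x => ∑ j ∈ Finset.univ.erase i, g (x j) / Real.sqrt n with hV
  have hVi : ∀ i x y, (∀ j, j ≠ i → x j = y j) → V i x = V i y := by
    intro i x y hxy
    refine Finset.sum_congr rfl fun j hj => ?_
    rw [hxy j (Finset.ne_of_mem_erase hj)]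
  have e1 : soEx P n (fun x => f' (soW g n x) - soW g n x * f (soW g n x)) =
      soEx P n (fun x => ∑ i, ((1 / n : ℝ) * (f' (soW g n x) - f' (V i x)) -
        g (x i) / Real.sqrt n * (f (soW g n x) - f (V i x) -
          g (x i) / Real.sqrt n * f' (V i x)))) := by
    have : ∀ x : Fin n → α, f' (soW g n x) - soW g n x * f (soW g n x) =
        ∑ i, ((1 / n : ℝ) * f' (soW g n x) - g (x i) / Real.sqrt n * f (soW g n x)) := by
      intro x
      have hw : ∑ i, g (x i) / Real.sqrt n * f (soW g n x) = soW g n x * f (soW g n x) := by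
        rw [← Finset.sum_mul]; rfl
      rw [Finset.sum_sub_distrib, hw]
      simp only [Finset.sum_const, Finset.card_univ, Fintype.card_fin, nsmul_eq_mul]
      field_simp
    simp only [this]
    rw [so_Ex_sum, so_Ex_sum]
    refine Finset.sum_congr rfl fun i _ => ?_
    have i1 : soEx P n (fun x => g (x i) / Real.sqrt n * f (V i x)) = 0 := by
      rw [so_indep hP1 i (fun a => g a / Real.sqrt n) (fun x => f (V i x))]
      · simp only [← mul_div_assoc]; rw [← Finset.sum_div, h1]; simp
      · intro x y hxy; simp only [hVi i x y hxy]
    have i2 : soEx P n (fun x => (g (x i) / Real.sqrt n) ^ 2 * f' (V i x)) =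
        (1 / n) * soEx P n (fun x => f' (V i x)) := by
      rw [so_indep hP1 i (fun a => (g a / Real.sqrt n) ^ 2) (fun x => f' (V i x))]
      · simp only [div_pow, hsq, ← mul_div_assoc]; rw [← Finset.sum_div, h2]
      · intro x y hxy; simp only [hVi i x y hxy]
    have : ∀ x : Fin n → α, ((1 / n : ℝ) * (f' (soW g n x) - f' (V i x)) -
        g (x i) / Real.sqrt n * (f (soW g n x) - f (V i x) -
          g (x i) / Real.sqrt n * f' (V i x))) =
        (((1 / n : ℝ) * f' (soW g n x) - g (x i) / Real.sqrt n * f (soW g n x)) +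
        (g (x i) / Real.sqrt n * f (V i x))) +
        ((g (x i) / Real.sqrt n) ^ 2 * f' (V i x) - (1 / n : ℝ) * f' (V i x)) := by
      intro x; ring
    simp only [this]
    rw [so_Ex_add, so_Ex_add _ (fun x => g (x i) / Real.sqrt n * f (V i x)), i1,
      so_Ex_sub (fun x => (g (x i) / Real.sqrt n) ^ 2 * f' (V i x)), i2, so_Ex_smul]
    ring
  rw [e1, ← so_Ex_smul]
  refine (so_Ex_abs hP0 _).trans (so_Ex_mono hP0 fun x => ?_)
  have hterm : ∀ i ∈ Finset.univ, |(1 / n : ℝ) * (f' (soW g n x) - f' (V i x)) -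
        g (x i) / Real.sqrt n * (f (soW g n x) - f (V i x) -
          g (x i) / Real.sqrt n * f' (V i x))| ≤ (1 + K ^ 2) / n * D (soW g n x) := by
    intro i _
    have hs : soW g n x = g (x i) / Real.sqrt n + V i x := so_W_split g n x i
    set ξ := g (x i) / Real.sqrt n with hξd
    have hb := abs_le.1 (hξ (x i))
    have hVW : |V i x - soW g n x| ≤ δ := by rw [hs, abs_le]; constructor <;> linarith
    have hWW : |soW g n x - soW g n x| ≤ δ := by simp [hδ0.le]
    have hD0 : 0 ≤ D (soW g n x) := (abs_nonneg _).trans (hD _ _ _ hWW hWW)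
    have hmv : |f (soW g n x) - f (V i x) - ξ * f' (V i x)| ≤ |ξ| * D (soW g n x) := by
      have hconv := Convex.norm_image_sub_le_of_norm_hasDerivWithin_le
        (f := fun w => f w - f' (V i x) * w) (f' := fun w => f' w - f' (V i x))
        (s := Set.uIcc (V i x) (soW g n x)) (C := D (soW g n x)) (x := V i x) (y := soW g n x)
        (fun w _ => by
          have := (hf w).sub ((hasDerivAt_id w).const_mul (f' (V i x)))
          exact (this.congr_deriv (by simp)).hasDerivWithinAt)
        (fun w hw => by
          refine hD _ _ _ ?_ hVW
          have h5 := Set.abs_sub_right_of_mem_uIcc hw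
          rw [abs_sub_comm] at h5
          exact h5.trans (by rw [abs_sub_comm]; exact hVW))
        (convex_uIcc _ _) Set.left_mem_uIcc Set.right_mem_uIcc
      simp only [Real.norm_eq_abs] at hconv
      have h6 : soW g n x - V i x = ξ := by linarith
      rw [h6] at hconv
      rw [mul_comm |ξ|]
      refine le_trans (le_of_eq ?_) hconv
      congr 1
      linear_combination (f' (V i x)) * h6
    have hξ2 : |ξ| * |ξ| ≤ K ^ 2 / n := by
      have := mul_le_mul (hξ (x i)) (hξ (x i)) (abs_nonneg _) hδ0.le
      refine this.trans (le_of_eq ?_)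
      rw [hδ, ← sq, div_pow, hsq]
    refine (abs_sub _ _).trans ?_
    rw [abs_mul, abs_mul, abs_of_pos (show (0:ℝ) < 1 / n by positivity)]
    have a1 := mul_le_mul_of_nonneg_left (hD _ _ _ hWW hVW) (show (0:ℝ) ≤ 1 / n by positivity)
    have a2 := mul_le_mul_of_nonneg_left hmv (abs_nonneg ξ)
    have a3 := mul_le_mul_of_nonneg_right hξ2 hD0
    have : (1 + K ^ 2) / n * D (soW g n x) =
      1 / n * D (soW g n x) + K ^ 2 / n * D (soW g n x) := by ring
    rw [this]
    linarith
  refine (Finset.abs_sum_le_sum_abs _ _).trans ((Finset.sum_le_sum hterm).trans (le_of_eq ?_))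
  simp; field_simp

end SO

lemma so_p_int : MeasureTheory.Integrable
    (fun x : ℝ => Real.exp (-x ^ 2 / 2) / Real.sqrt (2 * Real.pi)) := so_q_int.div_const _

lemma so_p_integral : ∫ x : ℝ, Real.exp (-x ^ 2 / 2) / Real.sqrt (2 * Real.pi) = 1 := by
  rw [MeasureTheory.integral_div, so_q_integral]
  exact div_self (by positivity)

lemma so_Iic (a : ℝ) :
    ∫ x in Set.Iic a, Real.exp (-x ^ 2 / 2) / Real.sqrt (2 * Real.pi) = 1 - gaussQ a := by
  have := intervalIntegral.integral_Iic_add_Ioi (b := a) so_p_int.integrableOn so_p_int.integrableOn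
  rw [so_p_integral] at this
  unfold gaussQ
  linarith

lemma so_Q_sub (a b : ℝ) : gaussQ a - gaussQ b =
    ∫ x in a..b, Real.exp (-x ^ 2 / 2) / Real.sqrt (2 * Real.pi) := by
  rw [← intervalIntegral.integral_Iic_sub_Iic so_p_int.integrableOn so_p_int.integrableOn,
    so_Iic, so_Iic]
  ring

lemma so_Q_le (a b : ℝ) (hab : a ≤ b) : gaussQ a - gaussQ b ≤ b - a := by
  rw [so_Q_sub]
  have : ∫ x in a..b, Real.exp (-x ^ 2 / 2) / Real.sqrt (2 * Real.pi) ≤ ∫ x in a..b, (1:ℝ) := by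
    refine intervalIntegral.integral_mono_on hab so_p_int.intervalIntegrable (by simp) ?_
    intro x _
    rw [div_le_one (by positivity)]
    have h1 : Real.exp (-x ^ 2 / 2) ≤ 1 := Real.exp_le_one_iff.2 (by nlinarith [sq_nonneg x])
    have h2 : 1 ≤ Real.sqrt (2 * Real.pi) := Real.one_le_sqrt.2 (by linarith [Real.pi_gt_three])
    linarith
  simpa using this

lemma so_Q_ge (z a b : ℝ) (hab : a ≤ b) (ha : z - 1 ≤ a) (hb : b ≤ z + 1) :
    Real.exp (-(|z| + 1) ^ 2 / 2) / Real.sqrt (2 * Real.pi) * (b - a) ≤ gaussQ a - gaussQ b := by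
  rw [so_Q_sub]
  have : ∫ x in a..b, Real.exp (-(|z| + 1) ^ 2 / 2) / Real.sqrt (2 * Real.pi) ≤
      ∫ x in a..b, Real.exp (-x ^ 2 / 2) / Real.sqrt (2 * Real.pi) := by
    refine intervalIntegral.integral_mono_on hab (by simp) so_p_int.intervalIntegrable ?_
    intro x hx
    refine div_le_div_of_nonneg_right (Real.exp_le_exp.2 ?_) (by positivity)
    have : x ^ 2 ≤ (|z| + 1) ^ 2 := by
      apply sq_le_sq'
      · linarith [neg_abs_le z, hx.1]
      · linarith [le_abs_self z, hx.2]
    linarith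
  rw [intervalIntegral.integral_const, smul_eq_mul] at this
  linarith

/-- Berry–Esseen for bounded i.i.d. summands. -/
lemma so_BE {α : Type*} [Fintype α] {P : α → ℝ}
    (hP0 : ∀ x, 0 ≤ P x) (hP1 : ∑ x, P x = 1) (g : α → ℝ)
    (h1 : ∑ a, P a * g a = 0) (h2 : ∑ a, P a * g a ^ 2 = 1) :
    ∃ C : ℝ, 0 < C ∧ ∀ n : ℕ, 0 < n → ∀ a : ℝ,
      |soEx P n (fun x => if soW g n x ≤ a then 1 else 0) - (1 - gaussQ a)| ≤
        C / Real.sqrt n := by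
  obtain ⟨B, hB, hst⟩ := so_stein
  obtain ⟨K, hK, hg⟩ : ∃ K : ℝ, 1 ≤ K ∧ ∀ a, |g a| ≤ K := by
    refine ⟨1 + ∑ a, |g a|, ?_, fun a => ?_⟩
    · linarith [Finset.sum_nonneg fun a (_ : a ∈ Finset.univ) => abs_nonneg (g a)]
    · linarith [Finset.single_le_sum (f := fun a => |g a|) (fun a _ => abs_nonneg (g a))
        (Finset.mem_univ a)]
  set C1 := (1 + K ^ 2) * (2 * (2 * (1 + K) + B) + 5 / 2 + (K ^ 2 + 1)) with hC1
  have hC1p : 0 < C1 := by positivity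
  refine ⟨(1 + C1) * K, by positivity, ?_⟩
  intro n hn a
  have hn' : (1:ℝ) ≤ n := by exact_mod_cast hn
  have hsn : 1 ≤ Real.sqrt n := Real.one_le_sqrt.2 hn'
  set δ := K / Real.sqrt n with hδ
  have hδ0 : 0 < δ := by positivity
  have hδK : δ ≤ K := div_le_self (by linarith) hsn
  have hEW : soEx P n (fun x => |soW g n x|) ≤ 1 :=
    so_first hP0 hP1 n _ 1 one_pos (by rw [so_W2 hP1 g h1 h2 n hn]; norm_num)
  have key : ∀ a : ℝ, ∃ h : ℝ → ℝ, (∀ w, 0 ≤ h w) ∧ (∀ w, h w ≤ 1) ∧ (∀ w ≤ a, h w = 1) ∧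
      (∀ w, a + δ ≤ w → h w = 0) ∧ 1 - gaussQ a - C1 * δ ≤ soEx P n (fun x => h (soW g n x)) ∧
      soEx P n (fun x => h (soW g n x)) ≤ 1 - gaussQ (a + δ) + C1 * δ := by
    intro a
    set h : ℝ → ℝ := fun w => max 0 (min 1 ((a + δ - w) / δ)) with hh
    have hc : Continuous h := by fun_prop
    have hh0 : ∀ w, 0 ≤ h w := fun w => le_max_left _ _
    have hh1 : ∀ w, h w ≤ 1 := fun w => max_le zero_le_one (min_le_left _ _)
    have hhl : ∀ w ≤ a, h w = 1 := by
      intro w hw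
      have : 1 ≤ (a + δ - w) / δ := by rw [le_div_iff₀ hδ0]; linarith
      simp only [hh]; rw [min_eq_left this]; simp
    have hhr : ∀ w, a + δ ≤ w → h w = 0 := by
      intro w hw
      have : (a + δ - w) / δ ≤ 0 := div_nonpos_of_nonpos_of_nonneg (by linarith) hδ0.le
      simp only [hh]; rw [max_eq_left ((min_le_right _ _).trans this)]
    obtain ⟨f, hf, hfB, hwf, hf2⟩ := hst h hc hh0 hh1
    set N := ∫ x, h x * (Real.exp (-x ^ 2 / 2) / Real.sqrt (2 * Real.pi)) with hN
    have hhp : MeasureTheory.Integrable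
        (fun x => h x * (Real.exp (-x ^ 2 / 2) / Real.sqrt (2 * Real.pi))) := by
      refine so_p_int.mono' (by fun_prop) (Filter.Eventually.of_forall fun x => ?_)
      have : 0 ≤ Real.exp (-x ^ 2 / 2) / Real.sqrt (2 * Real.pi) := by positivity
      rw [Real.norm_eq_abs, abs_of_nonneg (mul_nonneg (hh0 x) this)]
      exact mul_le_of_le_one_left this (hh1 x)
    have hNl : 1 - gaussQ a ≤ N := by
      rw [← so_Iic, ← MeasureTheory.integral_indicator measurableSet_Iic]
      refine MeasureTheory.integral_mono (so_p_int.indicator measurableSet_Iic) hhp fun x => ?_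
      have : 0 ≤ Real.exp (-x ^ 2 / 2) / Real.sqrt (2 * Real.pi) := by positivity
      by_cases hx : x ≤ a
      · rw [Set.indicator_of_mem (show x ∈ Set.Iic a from hx)]; simp only [hhl x hx, one_mul]; rfl
      · rw [Set.indicator_of_notMem (show x ∉ Set.Iic a from hx)]; exact mul_nonneg (hh0 x) this
    have hNr : N ≤ 1 - gaussQ (a + δ) := by
      rw [← so_Iic, ← MeasureTheory.integral_indicator measurableSet_Iic]
      refine MeasureTheory.integral_mono hhp (so_p_int.indicator measurableSet_Iic) fun x => ?_
      have : 0 ≤ Real.exp (-x ^ 2 / 2) / Real.sqrt (2 * Real.pi) := by positivity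
      by_cases hx : x ≤ a + δ
      · rw [Set.indicator_of_mem (show x ∈ Set.Iic (a + δ) from hx)]
        exact mul_le_of_le_one_left this (hh1 x)
      · rw [Set.indicator_of_notMem (show x ∉ Set.Iic (a + δ) from hx)]
        simp only [hhr x (not_le.1 hx).le, zero_mul]; rfl
    set D : ℝ → ℝ := fun w => 2 * δ * (2 * (|w| + δ) + B) +
      (if a - δ ≤ w ∧ w ≤ a + 2 * δ then 1 else 0) with hD
    have hDD : ∀ w u v, |u - w| ≤ δ → |v - w| ≤ δ →
        |(u * f u + (h u - N)) - (v * f v + (h v - N))| ≤ D w := by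
      intro w u v hu hv
      have hlip : |f u - f v| ≤ 2 * |u - v| := by
        have := Convex.norm_image_sub_le_of_norm_hasDerivWithin_le (f := f)
          (f' := fun w => w * f w + (h w - N)) (s := Set.univ) (C := 2) (x := v) (y := u)
          (fun w _ => (hf w).hasDerivWithinAt) (fun w _ => hf2 w) convex_univ trivial trivial
        exact this
      have hu' := abs_le.1 hu
      have hv' := abs_le.1 hv
      have huv : |u - v| ≤ 2 * δ := by rw [abs_le]; constructor <;> linarith
      have huw : |u| ≤ |w| + δ := by
        have := abs_add_le (u - w) w
        rw [sub_add_cancel] at this; linarith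
      have hpart1 : |u * f u - v * f v| ≤ 2 * δ * (2 * (|w| + δ) + B) := by
        have e : u * f u - v * f v = u * (f u - f v) + (u - v) * f v := by ring
        rw [e]
        refine (abs_add_le _ _).trans ?_
        rw [abs_mul, abs_mul]
        have b1 : |u| * |f u - f v| ≤ (|w| + δ) * (2 * (2 * δ)) :=
          mul_le_mul huw (hlip.trans (by linarith)) (abs_nonneg _) (by positivity)
        have b2 : |u - v| * |f v| ≤ 2 * δ * B :=
          mul_le_mul huv (hfB v) (abs_nonneg _) (by positivity)
        linarith
      have hpart2 : |h u - h v| ≤ (if a - δ ≤ w ∧ w ≤ a + 2 * δ then 1 else 0) := by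
        split_ifs with hw
        · rw [abs_le]; constructor <;> linarith [hh0 u, hh0 v, hh1 u, hh1 v]
        · rw [not_and_or, not_le, not_le] at hw
          rcases hw with hw | hw
          · rw [hhl u (by linarith), hhl v (by linarith)]; simp
          · rw [hhr u (by linarith), hhr v (by linarith)]; simp
      have e : (u * f u + (h u - N)) - (v * f v + (h v - N)) =
        (u * f u - v * f v) + (h u - h v) := by ring
      rw [e]
      exact (abs_add_le _ _).trans (add_le_add hpart1 hpart2)
    have hb := so_stein_bound hP0 hP1 g h1 h2 K hK hg n hn f
      (fun w => w * f w + (h w - N)) D hf hDD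
    have he : soEx P n (fun x => (soW g n x * f (soW g n x) + (h (soW g n x) - N)) -
        soW g n x * f (soW g n x)) = soEx P n (fun x => h (soW g n x)) - N := by
      simp only [add_sub_cancel_left]
      rw [so_Ex_sub, so_Ex_const hP1]
    rw [he] at hb
    have hED : soEx P n (fun x => D (soW g n x)) ≤
        (2 * (2 * (1 + K) + B) + 5 / 2 + (K ^ 2 + 1)) * δ := by
      have e : ∀ x : Fin n → α, D (soW g n x) = (4 * δ) * |soW g n x| + 2 * δ * (2 * δ + B) +
          (if a - δ ≤ soW g n x ∧ soW g n x ≤ a + 2 * δ then 1 else 0) := by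
        intro x; simp only [hD]; ring
      simp only [e]
      rw [so_Ex_add, so_Ex_add, so_Ex_smul, so_Ex_const hP1]
      have hcon := so_conc hP0 hP1 g h1 h2 K hK hg n hn (a - δ) (a + 2 * δ) (by linarith)
      rw [← hδ] at hcon
      have c1 : (K ^ 2 + 1) / Real.sqrt n ≤ (K ^ 2 + 1) * δ := by
        rw [hδ, ← mul_div_assoc]
        exact div_le_div_of_nonneg_right (le_mul_of_one_le_right (by positivity) hK) (by positivity)
      have c2 : 4 * δ * soEx P n (fun x => |soW g n x|) ≤ 4 * δ * 1 :=
        mul_le_mul_of_nonneg_left hEW (by positivity)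
      have c3 : δ * δ ≤ δ * K := mul_le_mul_of_nonneg_left hδK hδ0.le
      linarith
    have hb2 : |soEx P n (fun x => h (soW g n x)) - N| ≤ C1 * δ := by
      refine hb.trans ?_
      rw [hC1, mul_assoc]
      exact mul_le_mul_of_nonneg_left hED (by positivity)
    have hb3 := abs_le.1 hb2
    exact ⟨h, hh0, hh1, hhl, hhr, by linarith [hb3.1], by linarith [hb3.2]⟩
  have e : (1 + C1) * K / Real.sqrt n = δ + C1 * δ := by rw [hδ]; ring
  rw [e, abs_le]
  constructor
  · obtain ⟨h, hh0, hh1, hhl, hhr, hlo, hup⟩ := key (a - δ)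
    have : soEx P n (fun x => h (soW g n x)) ≤
        soEx P n (fun x => if soW g n x ≤ a then 1 else 0) := by
      refine so_Ex_mono hP0 fun x => ?_
      split_ifs with hx
      · exact hh1 _
      · rw [hhr _ (by linarith [not_le.1 hx])]
    have hq := so_Q_le (a - δ) a (by linarith)
    linarith
  · obtain ⟨h, hh0, hh1, hhl, hhr, hlo, hup⟩ := key a
    have : soEx P n (fun x => if soW g n x ≤ a then 1 else 0) ≤
        soEx P n (fun x => h (soW g n x)) := by
      refine so_Ex_mono hP0 fun x => ?_
      split_ifs with hx
      · rw [hhl _ hx]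
      · exact hh0 _
    have hq := so_Q_le a (a + δ) (by linarith)
    linarith

lemma so_Pr_mono {Ω : Type*} [Fintype Ω] {μ : Ω → ℝ} (h : ∀ x, 0 ≤ μ x) {A B : Set Ω}
    (hAB : A ⊆ B) : Pr μ A ≤ Pr μ B :=
  Finset.sum_le_sum fun x _ => Set.indicator_le_indicator_of_subset hAB h x

lemma so_Pr_compl {Ω : Type*} [Fintype Ω] (μ : Ω → ℝ) (A : Set Ω) :
    Pr μ A + Pr μ Aᶜ = ∑ x, μ x := by
  unfold Pr
  rw [← Finset.sum_add_distrib]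
  refine Finset.sum_congr rfl fun x _ => ?_
  rw [Set.indicator_self_add_compl_apply]

lemma so_code {𝒳 : Type} [Fintype 𝒳] (P : 𝒳 → ℝ) (hP0 : ∀ x, 0 ≤ P x) (n : ℕ) (ε : ℝ)
    (A : Finset (Fin n → 𝒳)) (hA : A.Nonempty) (hε : Pr (iidP P n) (A : Set (Fin n → 𝒳))ᶜ ≤ ε) :
    A.card ∈ {M : ℕ | 0 < M ∧ ∃ (f : (Fin n → 𝒳) → Fin M) (φ : Fin M → (Fin n → 𝒳)),
      Pr (iidP P n) {xs | φ (f xs) ≠ xs} ≤ ε} := by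
  classical
  refine ⟨hA.card_pos, fun x => if h : x ∈ A then A.equivFin ⟨x, h⟩ else ⟨0, hA.card_pos⟩,
    fun m => (A.equivFin.symm m : Fin n → 𝒳), ?_⟩
  refine (so_Pr_mono (so_iid_nonneg hP0 n) ?_).trans hε
  intro x hx hxA
  apply hx
  have : x ∈ A := hxA
  simp [this]

/-- **Second-order asymptotics for lossless source coding.**
For any `ε ∈ (0,1)`,
`log M*(n,ε) = n H(P) + √(n V(P)) Q⁻¹(ε) + O(log n)`,
where `z = Q⁻¹(ε)` is characterized by `Q(z) = ε`. -/
theorem lossless_second_order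
    {𝒳 : Type} [Fintype 𝒳] (P : 𝒳 → ℝ)
    (hP0 : ∀ x, 0 ≤ P x) (hP1 : ∑ x, P x = 1)
    (hV : 0 < sourceDispersion P)
    (ε : ℝ) (hε : ε ∈ Set.Ioo (0 : ℝ) 1) (z : ℝ) (hz : gaussQ z = ε) :
    ∃ C > (0 : ℝ), ∃ n₀ : ℕ, ∀ n ≥ n₀,
      |Real.log (Mstar P n ε)
          - (n * entropy P + Real.sqrt (n * sourceDispersion P) * z)| ≤
        C * Real.log n := by
  classical
  set V := sourceDispersion P with hVd
  set H := entropy P with hHd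
  have hsV : 0 < Real.sqrt V := Real.sqrt_pos.2 hV
  have hsqV : Real.sqrt V ^ 2 = V := Real.sq_sqrt hV.le
  set g : 𝒳 → ℝ := fun x => (-Real.log (P x) - H) / Real.sqrt V with hg
  have h1 : ∑ a, P a * g a = 0 := by
    simp only [hg, ← mul_div_assoc, mul_sub]
    rw [← Finset.sum_div, Finset.sum_sub_distrib, ← Finset.sum_mul, hP1, one_mul]
    have : ∑ x, P x * -Real.log (P x) = H := rfl
    rw [this]; simp
  have h2 : ∑ a, P a * g a ^ 2 = 1 := by
    simp only [hg, div_pow, hsqV, ← mul_div_assoc]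
    rw [← Finset.sum_div]
    exact div_self hV.ne'
  obtain ⟨C, hC, hBE⟩ := so_BE hP0 hP1 g h1 h2
  set c := Real.exp (-(|z| + 1) ^ 2 / 2) / Real.sqrt (2 * Real.pi) with hc
  have hc0 : 0 < c := by positivity
  set b := (C + 1) / c with hb
  have hb0 : 0 < b := by positivity
  have hcb : c * b = C + 1 := by rw [hb]; field_simp
  refine ⟨b * Real.sqrt V + 1, by positivity, ⌈b ^ 2⌉₊ + 3, ?_⟩
  intro n hn
  have hn3 : (3:ℝ) ≤ n := by
    have : 3 ≤ n := by omega
    exact_mod_cast this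
  have hnpos : 0 < n := by omega
  have hnR : (0:ℝ) < n := by linarith
  have hsn : 0 < Real.sqrt n := Real.sqrt_pos.2 hnR
  have hbn : b / Real.sqrt n ≤ 1 := by
    rw [div_le_one hsn]
    apply Real.le_sqrt_of_sq_le
    have : (⌈b ^ 2⌉₊ : ℝ) ≤ n := by
      have : ⌈b ^ 2⌉₊ ≤ n := by omega
      exact_mod_cast this
    exact (Nat.le_ceil _).trans this
  have hbn0 : 0 < b / Real.sqrt n := by positivity
  have hlog : 1 ≤ Real.log n := by
    rw [Real.le_log_iff_exp_le hnR]
    linarith [Real.exp_one_lt_d9]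
  have hsnV : Real.sqrt (n * V) = Real.sqrt n * Real.sqrt V := Real.sqrt_mul hnR.le V
  have hiid : ∀ x : Fin n → 𝒳, iidP P n x ≠ 0 →
      iidP P n x = Real.exp (-(n * H + Real.sqrt (n * V) * soW g n x)) := by
    intro x hx
    have hx' : ∀ i, P (x i) ≠ 0 := fun i => Finset.prod_ne_zero_iff.1 hx i (Finset.mem_univ i)
    have hs : Real.sqrt (n * V) * soW g n x = ∑ i, (-Real.log (P (x i)) - H) := by
      unfold soW
      rw [Finset.mul_sum]
      refine Finset.sum_congr rfl fun i _ => ?_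
      rw [hsnV]; simp only [hg]; field_simp
    rw [hs, Finset.sum_sub_distrib]
    simp only [Finset.sum_neg_distrib, Finset.sum_const, Finset.card_univ, Fintype.card_fin,
      nsmul_eq_mul]
    rw [show -((n:ℝ) * H + (-∑ i, Real.log (P (x i)) - n * H)) = ∑ i, Real.log (P (x i)) by ring,
      Real.exp_sum]
    exact Finset.prod_congr rfl fun i _ =>
      (Real.exp_log (lt_of_le_of_ne (hP0 _) (hx' i).symm)).symm
  have hiid0 := so_iid_nonneg hP0 n
  have hiid1 := so_iid_sum hP1 n
  have hmulW : ∀ s : ℝ, Real.sqrt (n * V) * (z + s / Real.sqrt n) =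
      Real.sqrt (n * V) * z + s * Real.sqrt V := by
    intro s; rw [hsnV]; field_simp
  -- achievability
  set A : Finset (Fin n → 𝒳) := Finset.univ.filter
    (fun x => iidP P n x ≠ 0 ∧ soW g n x ≤ z + b / Real.sqrt n) with hA
  have hPrA : 1 - ε ≤ Pr (iidP P n) (A : Set (Fin n → 𝒳)) := by
    have e : Pr (iidP P n) (A : Set (Fin n → 𝒳)) =
        soEx P n (fun x => if soW g n x ≤ z + b / Real.sqrt n then 1 else 0) := by
      unfold Pr soEx
      refine Finset.sum_congr rfl fun x _ => ?_
      by_cases hx : iidP P n x = 0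
      · simp [Set.indicator, hx]
      · simp [Set.indicator, hA, hx]
    rw [e]
    have b1 := abs_le.1 (hBE n hnpos (z + b / Real.sqrt n))
    have b2 := so_Q_ge z z (z + b / Real.sqrt n) (by linarith) (by linarith) (by linarith)
    rw [← hc, add_sub_cancel_left, ← mul_div_assoc, hcb, add_div, hz] at b2
    have : 0 < 1 / Real.sqrt n := by positivity
    linarith [b1.1]
  have hAne : A.Nonempty := by
    by_contra h
    rw [Finset.not_nonempty_iff_eq_empty] at h
    rw [h] at hPrA
    simp [Pr] at hPrA
    linarith [hε.2]
  have hAmem := so_code P hP0 n ε A hAne (by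
    have := so_Pr_compl (iidP P n) (A : Set (Fin n → 𝒳))
    rw [hiid1] at this; linarith)
  have hMle : Mstar P n ε ≤ A.card := Nat.sInf_le hAmem
  have hMmem := Nat.sInf_mem ⟨_, hAmem⟩
  change Mstar P n ε ∈ _ at hMmem
  obtain ⟨hMpos, f, φ, hfφ⟩ := hMmem
  have hMposR : (0:ℝ) < Mstar P n ε := by exact_mod_cast hMpos
  have hupper : Real.log (Mstar P n ε) ≤
      n * H + Real.sqrt (n * V) * z + b * Real.sqrt V := by
    have hcard : (A.card : ℝ) * Real.exp (-(n * H + Real.sqrt (n * V) * z + b * Real.sqrt V)) ≤ 1 := by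
      rw [← hiid1, ← nsmul_eq_mul]
      refine (Finset.card_nsmul_le_sum A (iidP P n) _ ?_).trans
        (Finset.sum_le_sum_of_subset_of_nonneg (Finset.subset_univ _) fun x _ _ => hiid0 x)
      intro x hx
      obtain ⟨-, hx1, hx2⟩ := Finset.mem_filter.1 hx
      rw [hiid x hx1]
      apply Real.exp_le_exp.2
      have := mul_le_mul_of_nonneg_left hx2 (Real.sqrt_nonneg (n * V))
      rw [hmulW] at this
      linarith
    rw [Real.log_le_iff_le_exp hMposR]
    have hM' : (Mstar P n ε : ℝ) ≤ A.card := by exact_mod_cast hMle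
    rw [Real.exp_neg, ← div_eq_mul_inv, div_le_one (Real.exp_pos _)] at hcard
    exact hM'.trans hcard
  -- converse
  have hlower : n * H + Real.sqrt (n * V) * z - b * Real.sqrt V - Real.log n / 2 ≤
      Real.log (Mstar P n ε) := by
    set t := n * H + Real.sqrt (n * V) * z - b * Real.sqrt V with ht
    set Bs : Finset (Fin n → 𝒳) := Finset.univ.filter (fun x => φ (f x) = x) with hBs
    have hBcard : (Bs.card : ℝ) ≤ Mstar P n ε := by
      have : Bs.card ≤ (Finset.univ : Finset (Fin (Mstar P n ε))).card := by
        refine Finset.card_le_card_of_injOn f (fun _ _ => Finset.mem_coe.2 (Finset.mem_univ _)) ?_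
        intro x hx y hy hxy
        have hx' := (Finset.mem_filter.1 (Finset.mem_coe.1 hx)).2
        have hy' := (Finset.mem_filter.1 (Finset.mem_coe.1 hy)).2
        rw [← hx', ← hy', hxy]
      rw [Finset.card_univ, Fintype.card_fin] at this
      exact_mod_cast this
    have hPrB : 1 - ε ≤ ∑ x ∈ Bs, iidP P n x := by
      have h3 := so_Pr_compl (iidP P n) {xs | φ (f xs) ≠ xs}
      rw [hiid1] at h3
      have h4 : Pr (iidP P n) {xs | φ (f xs) ≠ xs}ᶜ = ∑ x ∈ Bs, iidP P n x := by
        unfold Pr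
        rw [hBs, Finset.sum_filter]
        refine Finset.sum_congr rfl fun x _ => ?_
        simp [Set.indicator]
      linarith
    have hsplit : ∑ x ∈ Bs, iidP P n x ≤
        soEx P n (fun x => if soW g n x ≤ z + (-b) / Real.sqrt n then 1 else 0) +
          Bs.card * Real.exp (-t) := by
      have h3 : ∀ x ∈ Bs, iidP P n x ≤
          iidP P n x * (if soW g n x ≤ z + (-b) / Real.sqrt n then 1 else 0) + Real.exp (-t) := by
        intro x _
        split_ifs with hx
        · linarith [Real.exp_pos (-t)]
        · rw [mul_zero, zero_add]
          by_cases hx0 : iidP P n x = 0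
          · rw [hx0]; exact (Real.exp_pos _).le
          · rw [hiid x hx0]
            apply Real.exp_le_exp.2
            have := mul_le_mul_of_nonneg_left (not_le.1 hx).le (Real.sqrt_nonneg (n * V))
            rw [hmulW] at this
            linarith
      refine (Finset.sum_le_sum h3).trans ?_
      rw [Finset.sum_add_distrib, Finset.sum_const, nsmul_eq_mul]
      refine add_le_add ?_ le_rfl
      refine Finset.sum_le_sum_of_subset_of_nonneg (Finset.subset_univ _) fun x _ _ => ?_
      refine mul_nonneg (hiid0 x) ?_
      split_ifs <;> norm_num
    have b1 := abs_le.1 (hBE n hnpos (z + (-b) / Real.sqrt n))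
    have hnegb : (-b) / Real.sqrt n = -(b / Real.sqrt n) := neg_div _ _
    have b2 := so_Q_ge z (z + (-b) / Real.sqrt n) z (by linarith) (by linarith) (by linarith)
    rw [← hc, show z - (z + (-b) / Real.sqrt n) = b / Real.sqrt n by rw [hnegb]; ring,
      ← mul_div_assoc, hcb, add_div, hz] at b2
    have h5 : 1 / Real.sqrt n ≤ Bs.card * Real.exp (-t) := by linarith [b1.2]
    have h6 : 1 / Real.sqrt n ≤ Mstar P n ε * Real.exp (-t) :=
      h5.trans (mul_le_mul_of_nonneg_right hBcard (Real.exp_pos _).le)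
    have h7 := Real.log_le_log (by positivity) h6
    rw [Real.log_mul hMposR.ne' (Real.exp_pos _).ne', Real.log_exp, one_div, Real.log_inv,
      Real.log_sqrt hnR.le] at h7
    linarith
  have hbV : 0 ≤ b * Real.sqrt V := by positivity
  have hfin : b * Real.sqrt V ≤ b * Real.sqrt V * Real.log n := le_mul_of_one_le_right hbV hlog
  rw [abs_le]
  constructor <;> linarith

end
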